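/- arXiv:2512.01745 — 3 statements merged into one kernel-verified Lean document; each statement's English description precedes it below -/
import Mathlib

section
/- Let ρ_ABC be a pure tripartite state and let α ∈ (0,2). Then T↓_α(A|B)_ρ + T↓_{2−α}(A|C)_ρ = 0, where the conditional entropies are computed from the reduced states ρ_AB = Tr_C(ρ_ABC) and ρ_AC = Tr_B(ρ_ABC). -/
open scoped Kronecker ComplexOrder

noncomputable section

namespace QIT

variable {n : Type*} [Fintype n] [DecidableEq n]

/-- Real trace of a complex matrix. -/
def rtr (A : Matrix n n ℂ) : ℝ := (Matrix.trace A).re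

/-- Apply a real function to a hermitian matrix via spectral decomposition
(junk value `0` for non-hermitian input). -/
def mfun (f : ℝ → ℝ) (A : Matrix n n ℂ) : Matrix n n ℂ :=
  if hA : A.IsHermitian then
    (Matrix.IsHermitian.eigenvectorUnitary hA : Matrix n n ℂ) *
      Matrix.diagonal (fun i => ((f (hA.eigenvalues i) : ℝ) : ℂ)) *
      (star (Matrix.IsHermitian.eigenvectorUnitary hA : Matrix n n ℂ))
  else 0

/-- Real power of a positive semidefinite matrix (with the conventions
`0 ^ p = 0` for `p ≠ 0`, i.e. powers are taken on the support). -/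
def mpow (A : Matrix n n ℂ) (p : ℝ) : Matrix n n ℂ := mfun (fun x => x ^ p) A

/-- Matrix base-2 logarithm (on the support). -/
def mlog (A : Matrix n n ℂ) : Matrix n n ℂ := mfun (Real.logb 2) A

/-- A quantum state: positive semidefinite with unit trace. -/
def IsState (ρ : Matrix n n ℂ) : Prop := ρ.PosSemidef ∧ Matrix.trace ρ = 1

/-- A pure state: a state of rank one. -/
def IsPureState (ρ : Matrix n n ℂ) : Prop := IsState ρ ∧ ρ.rank = 1

/-- The support (range) ordering: `supp ρ ⊆ supp σ`, expressed as
`ker σ ≤ ker ρ`. -/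
def SuppLE (ρ σ : Matrix n n ℂ) : Prop := ∀ v : n → ℂ, σ.mulVec v = 0 → ρ.mulVec v = 0

/-- Trace norm ‖X‖₁ = Tr √(X† X). -/
def traceNorm (X : Matrix n n ℂ) : ℝ := rtr (mpow (X.conjTranspose * X) (2⁻¹ : ℝ))

/-- von Neumann entropy (base 2). -/
def vnEnt (ρ : Matrix n n ℂ) : ℝ := - rtr (ρ * mlog ρ)

/-- Umegaki relative entropy (base 2), real-valued on its finiteness domain. -/
def relEnt (ρ σ : Matrix n n ℂ) : ℝ := rtr (ρ * mlog ρ) - rtr (ρ * mlog σ)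

/-- The sandwiched trace functional Tr{(σ^((1-α)/(2α)) ρ σ^((1-α)/(2α)))^α}. -/
def sandTr (α : ℝ) (ρ σ : Matrix n n ℂ) : ℝ :=
  rtr (mpow (mpow σ ((1 - α) / (2 * α)) * ρ * mpow σ ((1 - α) / (2 * α))) α)

/-- Sandwiched Rényi relative entropy (base 2). -/
def sandRenyi (α : ℝ) (ρ σ : Matrix n n ℂ) : ℝ := (α - 1)⁻¹ * Real.logb 2 (sandTr α ρ σ)

/-- Sandwiched Tsallis relative entropy. -/
def sandTsallis (α : ℝ) (ρ σ : Matrix n n ℂ) : ℝ := (α - 1)⁻¹ * (sandTr α ρ σ - 1)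

/-- (Non-sandwiched) Tsallis relative entropy. -/
def tsallisRel (α : ℝ) (ρ σ : Matrix n n ℂ) : ℝ :=
  (α - 1)⁻¹ * (rtr (mpow ρ α * mpow σ (1 - α)) - 1)

/-- Tsallis entropy of a state. -/
def tsallisEnt (α : ℝ) (ρ : Matrix n n ℂ) : ℝ := (1 - α)⁻¹ * (rtr (mpow ρ α) - 1)

variable {a b c r : Type*} [Fintype a] [DecidableEq a] [Fintype b] [DecidableEq b]
  [Fintype c] [DecidableEq c] [Fintype r] [DecidableEq r]

/-- Partial trace over the first tensor factor. -/
def ptraceA (ρ : Matrix (a × b) (a × b) ℂ) : Matrix b b ℂ :=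
  Matrix.of fun i j => ∑ k : a, ρ (k, i) (k, j)

/-- Partial trace over the second tensor factor. -/
def ptraceB (ρ : Matrix (a × b) (a × b) ℂ) : Matrix a a ℂ :=
  Matrix.of fun i j => ∑ k : b, ρ (i, k) (j, k)

/-- Conditional sandwiched Rényi entropy H̃↓_α(A|B). -/
def condRenyiDown (α : ℝ) (ρ : Matrix (a × b) (a × b) ℂ) : ℝ :=
  - sandRenyi α ρ ((1 : Matrix a a ℂ) ⊗ₖ ptraceA ρ)

/-- Conditional sandwiched Tsallis entropy T̃↓_α(A|B). -/
def condTsallisSandDown (α : ℝ) (ρ : Matrix (a × b) (a × b) ℂ) : ℝ :=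
  - sandTsallis α ρ ((1 : Matrix a a ℂ) ⊗ₖ ptraceA ρ)

/-- Optimized conditional sandwiched Tsallis entropy T̃↑_α(A|B). -/
def condTsallisSandUp (α : ℝ) (ρ : Matrix (a × b) (a × b) ℂ) : ℝ :=
  - ⨅ σ : {σ : Matrix b b ℂ // IsState σ}, sandTsallis α ρ ((1 : Matrix a a ℂ) ⊗ₖ σ.1)

/-- Conditional (non-sandwiched) Tsallis entropy T↓_α(A|B). -/
def condTsallisDown (α : ℝ) (ρ : Matrix (a × b) (a × b) ℂ) : ℝ :=
  - tsallisRel α ρ ((1 : Matrix a a ℂ) ⊗ₖ ptraceA ρ)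

/-- Conditional von Neumann entropy H(A|B) = S(AB) - S(B). -/
def condvnEnt (ρ : Matrix (a × b) (a × b) ℂ) : ℝ := vnEnt ρ - vnEnt (ptraceA ρ)

/-- The extension `N ⊗ I_r` of a linear map on matrices. -/
def tensorId (N : Matrix a a ℂ →ₗ[ℂ] Matrix b b ℂ) (r : Type*) [Fintype r] [DecidableEq r] :
    Matrix (a × r) (a × r) ℂ →ₗ[ℂ] Matrix (b × r) (b × r) ℂ where
  toFun ρ := Matrix.of fun p q => N (Matrix.of fun x y => ρ (x, p.2) (y, q.2)) p.1 q.1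
  map_add' ρ₁ ρ₂ := by
    ext p q
    have h : (Matrix.of fun x y => (ρ₁ + ρ₂) (x, p.2) (y, q.2))
        = (Matrix.of fun x y => ρ₁ (x, p.2) (y, q.2))
          + (Matrix.of fun x y => ρ₂ (x, p.2) (y, q.2)) := by
      ext x y; simp
    show N (Matrix.of fun x y => (ρ₁ + ρ₂) (x, p.2) (y, q.2)) p.1 q.1 = _
    rw [h, map_add]; rfl
  map_smul' z ρ := by
    ext p q
    have h : (Matrix.of fun x y => (z • ρ) (x, p.2) (y, q.2))
        = z • (Matrix.of fun x y => ρ (x, p.2) (y, q.2)) := by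
      ext x y; simp
    show N (Matrix.of fun x y => (z • ρ) (x, p.2) (y, q.2)) p.1 q.1 = _
    rw [h, map_smul]; rfl

/-- The extension `I_r ⊗ M` of a linear map on matrices. -/
def idTensor (M : Matrix a a ℂ →ₗ[ℂ] Matrix b b ℂ) (r : Type*) [Fintype r] [DecidableEq r] :
    Matrix (r × a) (r × a) ℂ →ₗ[ℂ] Matrix (r × b) (r × b) ℂ where
  toFun ρ := Matrix.of fun p q => M (Matrix.of fun x y => ρ (p.1, x) (q.1, y)) p.2 q.2
  map_add' ρ₁ ρ₂ := by
    ext p q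
    have h : (Matrix.of fun x y => (ρ₁ + ρ₂) (p.1, x) (q.1, y))
        = (Matrix.of fun x y => ρ₁ (p.1, x) (q.1, y))
          + (Matrix.of fun x y => ρ₂ (p.1, x) (q.1, y)) := by
      ext x y; simp
    show M (Matrix.of fun x y => (ρ₁ + ρ₂) (p.1, x) (q.1, y)) p.2 q.2 = _
    rw [h, map_add]; rfl
  map_smul' z ρ := by
    ext p q
    have h : (Matrix.of fun x y => (z • ρ) (p.1, x) (q.1, y))
        = z • (Matrix.of fun x y => ρ (p.1, x) (q.1, y)) := by
      ext x y; simp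
    show M (Matrix.of fun x y => (z • ρ) (p.1, x) (q.1, y)) p.2 q.2 = _
    rw [h, map_smul]; rfl

/-- A quantum channel: trace preserving and completely positive. -/
def IsChannel (N : Matrix a a ℂ →ₗ[ℂ] Matrix b b ℂ) : Prop :=
  (∀ ρ : Matrix a a ℂ, Matrix.trace (N ρ) = Matrix.trace ρ) ∧
  ∀ (k : ℕ) (ρ : Matrix (a × Fin k) (a × Fin k) ℂ), ρ.PosSemidef →
    (tensorId N (Fin k) ρ).PosSemidef

/-- The maximally mixed state on system `b`. -/
def maxMixed (b : Type*) [Fintype b] [DecidableEq b] : Matrix b b ℂ :=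
  ((Fintype.card b : ℂ))⁻¹ • (1 : Matrix b b ℂ)

/-- The completely randomizing (depolarizing) channel. -/
def randomizing (a b : Type*) [Fintype a] [DecidableEq a] [Fintype b] [DecidableEq b] :
    Matrix a a ℂ →ₗ[ℂ] Matrix b b ℂ :=
  (Matrix.traceLinearMap a ℂ ℂ).smulRight (maxMixed b)

/-- The replacer channel `ρ ↦ Tr(ρ) σ`. -/
def replacer (a : Type*) [Fintype a] [DecidableEq a] (σ : Matrix b b ℂ) :
    Matrix a a ℂ →ₗ[ℂ] Matrix b b ℂ :=
  (Matrix.traceLinearMap a ℂ ℂ).smulRight σ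

/-- Channel (Umegaki) relative entropy: supremum over all finite reference systems. -/
def chRelEnt (N M : Matrix a a ℂ →ₗ[ℂ] Matrix b b ℂ) : ℝ :=
  ⨆ p : Σ k : ℕ, {ρ : Matrix (a × Fin k) (a × Fin k) ℂ // IsState ρ},
    relEnt (tensorId N (Fin p.1) p.2.1) (tensorId M (Fin p.1) p.2.1)

/-- Channel sandwiched Rényi relative entropy. -/
def chSandRenyi (α : ℝ) (N M : Matrix a a ℂ →ₗ[ℂ] Matrix b b ℂ) : ℝ :=
  ⨆ p : Σ k : ℕ, {ρ : Matrix (a × Fin k) (a × Fin k) ℂ // IsState ρ},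
    sandRenyi α (tensorId N (Fin p.1) p.2.1) (tensorId M (Fin p.1) p.2.1)

/-- Channel sandwiched Tsallis relative entropy. -/
def chSandTsallis (α : ℝ) (N M : Matrix a a ℂ →ₗ[ℂ] Matrix b b ℂ) : ℝ :=
  ⨆ p : Σ k : ℕ, {ρ : Matrix (a × Fin k) (a × Fin k) ℂ // IsState ρ},
    sandTsallis α (tensorId N (Fin p.1) p.2.1) (tensorId M (Fin p.1) p.2.1)

/-- Diamond distance between two maps. -/
def diamondDist (N M : Matrix a a ℂ →ₗ[ℂ] Matrix b b ℂ) : ℝ :=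
  ⨆ p : Σ k : ℕ, {ρ : Matrix (a × Fin k) (a × Fin k) ℂ // IsState ρ},
    traceNorm (tensorId N (Fin p.1) p.2.1 - tensorId M (Fin p.1) p.2.1)

/-- Entropy of a quantum channel. -/
def chEnt (N : Matrix a a ℂ →ₗ[ℂ] Matrix b b ℂ) : ℝ :=
  Real.logb 2 (Fintype.card b) - chRelEnt N (randomizing a b)

/-- α-Rényi entropy of a quantum channel. -/
def chRenyiEnt (α : ℝ) (N : Matrix a a ℂ →ₗ[ℂ] Matrix b b ℂ) : ℝ :=
  Real.logb 2 (Fintype.card b) - chSandRenyi α N (randomizing a b)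

/-- α-Tsallis entropy of a quantum channel. -/
def chTsallisEnt (α : ℝ) (N : Matrix a a ℂ →ₗ[ℂ] Matrix b b ℂ) : ℝ :=
  ((Fintype.card b : ℝ) ^ (1 - α) - 1) / (1 - α)
    - (Fintype.card b : ℝ) ^ (1 - α) * chSandTsallis α N (randomizing a b)


/-- Partial trace over the third factor of a tripartite system. -/
def ptraceThird {a b c : Type*} [Fintype a] [DecidableEq a] [Fintype b] [DecidableEq b]
    [Fintype c] [DecidableEq c] (ρ : Matrix (a × b × c) (a × b × c) ℂ) :
    Matrix (a × b) (a × b) ℂ :=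
  Matrix.of fun i j => ∑ k : c, ρ (i.1, i.2, k) (j.1, j.2, k)

/-- Partial trace over the middle factor of a tripartite system. -/
def ptraceMid {a b c : Type*} [Fintype a] [DecidableEq a] [Fintype b] [DecidableEq b]
    [Fintype c] [DecidableEq c] (ρ : Matrix (a × b × c) (a × b × c) ℂ) :
    Matrix (a × c) (a × c) ℂ :=
  Matrix.of fun i j => ∑ k : b, ρ (i.1, k, i.2) (j.1, k, j.2)

/-- Functional calculus intertwines: if two matrices in spectral form are intertwined by `X`, so
are their images under any function. -/
lemma spectral_intertwine {m n : Type*} [Fintype m] [DecidableEq m] [Fintype n] [DecidableEq n]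
    {U : Matrix m m ℂ} {V : Matrix n n ℂ} (hU : star U * U = 1) (hU' : U * star U = 1)
    (hV : star V * V = 1) (hV' : V * star V = 1) (d : m → ℝ) (e : n → ℝ) (X : Matrix m n ℂ)
    (f : ℝ → ℝ)
    (h : U * Matrix.diagonal (fun i => (d i : ℂ)) * star U * X =
      X * (V * Matrix.diagonal (fun i => (e i : ℂ)) * star V)) :
    U * Matrix.diagonal (fun i => (f (d i) : ℂ)) * star U * X =
      X * (V * Matrix.diagonal (fun i => (f (e i) : ℂ)) * star V) := by
  obtain ⟨Y, rfl⟩ : ∃ Y : Matrix m n ℂ, X = U * Y * star V := by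
    refine ⟨star U * X * V, ?_⟩
    calc X = (U * star U) * X * (V * star V) := by rw [hU', hV', Matrix.one_mul, Matrix.mul_one]
      _ = _ := by simp only [Matrix.mul_assoc]
  have key : ∀ (D : Matrix m m ℂ) (E : Matrix n n ℂ),
      U * D * star U * (U * Y * star V) = U * (D * Y) * star V ∧
      U * Y * star V * (V * E * star V) = U * (Y * E) * star V := by
    intro D E
    constructor
    · calc _ = U * D * (star U * U) * Y * star V := by simp only [Matrix.mul_assoc]
        _ = _ := by rw [hU, Matrix.mul_one]; simp only [Matrix.mul_assoc]
    · calc _ = U * Y * (star V * V) * E * star V := by simp only [Matrix.mul_assoc]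
        _ = _ := by rw [hV, Matrix.mul_one]; simp only [Matrix.mul_assoc]
  rw [(key _ 0).1, (key 0 _).2] at h ⊢
  have h' : Matrix.diagonal (fun i => (d i : ℂ)) * Y = Y * Matrix.diagonal (fun i => (e i : ℂ)) := by
    have := congrArg (fun Z => star U * Z * V) h
    have simpl : ∀ Z : Matrix m n ℂ, star U * (U * Z * star V) * V = Z := by
      intro Z
      calc _ = (star U * U) * Z * (star V * V) := by simp only [Matrix.mul_assoc]
        _ = Z := by rw [hU, hV, Matrix.one_mul, Matrix.mul_one]
    simpa only [simpl] using this
  congr 2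
  ext i j
  have hij := congrFun (congrFun h' i) j
  rw [Matrix.diagonal_mul, Matrix.mul_diagonal, mul_comm] at hij ⊢
  by_cases hY : Y i j = 0
  · simp [hY]
  · have : d i = e j := by exact_mod_cast mul_left_cancel₀ hY hij
    rw [this]

lemma isHermitian_eq_spectral {A : Matrix n n ℂ} (hA : A.IsHermitian) :
    A = (hA.eigenvectorUnitary : Matrix n n ℂ) *
      Matrix.diagonal (fun i => (hA.eigenvalues i : ℂ)) *
      star (hA.eigenvectorUnitary : Matrix n n ℂ) := by
  conv_lhs => rw [hA.spectral_theorem]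
  rfl

lemma mfun_intertwine {m n : Type*} [Fintype m] [DecidableEq m] [Fintype n] [DecidableEq n]
    {A : Matrix m m ℂ} {B : Matrix n n ℂ} (hA : A.IsHermitian) (hB : B.IsHermitian)
    (X : Matrix m n ℂ) (f : ℝ → ℝ) (h : A * X = X * B) : mfun f A * X = X * mfun f B := by
  rw [mfun, mfun, dif_pos hA, dif_pos hB]
  apply spectral_intertwine
  any_goals simp
  rw [← isHermitian_eq_spectral hA, ← isHermitian_eq_spectral hB, h]

/-- `mfun` may be computed from any unitary diagonalization. -/
lemma mfun_spectral {U : Matrix n n ℂ} (hU : star U * U = 1) (d : n → ℝ) (f : ℝ → ℝ) :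
    mfun f (U * Matrix.diagonal (fun i => (d i : ℂ)) * star U) =
      U * Matrix.diagonal (fun i => (f (d i) : ℂ)) * star U := by
  have hH : (U * Matrix.diagonal (fun i => (d i : ℂ)) * star U).IsHermitian := by
    apply Matrix.isHermitian_mul_mul_conjTranspose
    rw [Matrix.IsHermitian, Matrix.diagonal_conjTranspose]
    congr 1
    ext i
    simp
  rw [mfun, dif_pos hH]
  have := spectral_intertwine (U := (hH.eigenvectorUnitary : Matrix n n ℂ)) (V := U)
    (by simp) (by simp) hU (mul_eq_one_comm.mp hU) hH.eigenvalues d 1 f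
    (by rw [← isHermitian_eq_spectral hH, Matrix.mul_one, Matrix.one_mul])
  rwa [Matrix.mul_one, Matrix.one_mul] at this

lemma mfun_transpose {A : Matrix n n ℂ} (hA : A.IsHermitian) (f : ℝ → ℝ) :
    mfun f A.transpose = (mfun f A).transpose := by
  set U := (hA.eigenvectorUnitary : Matrix n n ℂ) with hUdef
  have hstar : star (star U).transpose = U.transpose := by
    ext i j
    simp [Matrix.star_apply]
  have hT : ∀ d : n → ℂ, (U * Matrix.diagonal d * star U).transpose =
      (star U).transpose * Matrix.diagonal d * star (star U).transpose := by
    intro d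
    rw [hstar, Matrix.transpose_mul, Matrix.transpose_mul, Matrix.diagonal_transpose,
      Matrix.mul_assoc]
  have hU : star (star U).transpose * (star U).transpose = 1 := by
    rw [hstar, ← Matrix.transpose_mul, hUdef]
    simp
  conv_lhs => rw [isHermitian_eq_spectral hA]
  rw [hT, mfun_spectral hU, mfun, dif_pos hA, hT]

lemma mfun_one_kronecker {A : Matrix b b ℂ} (hA : A.IsHermitian) (f : ℝ → ℝ) :
    mfun f ((1 : Matrix a a ℂ) ⊗ₖ A) = (1 : Matrix a a ℂ) ⊗ₖ mfun f A := by
  have hK : ((1 : Matrix a a ℂ) ⊗ₖ A).IsHermitian := by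
    rw [Matrix.IsHermitian, Matrix.conjTranspose_kronecker, Matrix.conjTranspose_one, hA.eq]
  ext ⟨i, j⟩ ⟨k, l⟩
  let E : Matrix (a × b) b ℂ := Matrix.of fun p q => (1 : Matrix (a × b) (a × b) ℂ) p (k, q)
  have hE : ∀ (B : Matrix (a × b) (a × b) ℂ) p q, (B * E) p q = B p (k, q) := by
    intro B p q
    simp [E, Matrix.mul_apply, Matrix.one_apply]
  have hE' : ∀ (B : Matrix b b ℂ) p q, (E * B) p q = ((1 : Matrix a a ℂ) ⊗ₖ B) p (k, q) := by
    rintro B ⟨p, p'⟩ q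
    simp [E, Matrix.mul_apply, Matrix.one_apply, Prod.ext_iff, ite_and]
  have h := mfun_intertwine hK hA E f (by ext p q; rw [hE, hE'])
  rw [← hE (mfun f _) (i, j) l, h, hE']

lemma mfun_eq_mul {A : Matrix n n ℂ} (hA : A.PosSemidef) {f g : ℝ → ℝ}
    (h : ∀ x, 0 ≤ x → f x = g x * x) : mfun f A = mfun g A * A := by
  conv_rhs => rw [isHermitian_eq_spectral hA.1]
  rw [mfun_spectral (by simp), mfun, dif_pos hA.1]
  set U := (hA.1.eigenvectorUnitary : Matrix n n ℂ)
  have hU : star U * U = 1 := by simp [U]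
  calc _ = U * (Matrix.diagonal (fun i => (g (hA.1.eigenvalues i) : ℂ)) *
        Matrix.diagonal (fun i => (hA.1.eigenvalues i : ℂ))) * star U := by
        rw [Matrix.diagonal_mul_diagonal]
        congr 3
        ext i
        rw [h _ (hA.eigenvalues_nonneg i)]
        push_cast
        rfl
    _ = U * Matrix.diagonal (fun i => (g (hA.1.eigenvalues i) : ℂ)) * (star U * U) *
        Matrix.diagonal (fun i => (hA.1.eigenvalues i : ℂ)) * star U := by
        rw [hU, Matrix.mul_one]
        simp only [Matrix.mul_assoc]
    _ = _ := by simp only [Matrix.mul_assoc]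

lemma mpow_mul_conjTranspose {m n : Type*} [Fintype m] [DecidableEq m] [Fintype n] [DecidableEq n]
    (M : Matrix m n ℂ) {p : ℝ} (hp : p ≠ 0) :
    mpow (M * M.conjTranspose) p = M * mpow (M.conjTranspose * M) (p - 1) * M.conjTranspose := by
  have hf : ∀ x : ℝ, 0 ≤ x → x ^ p = x ^ (p - 1) * x := by
    intro x hx
    rcases hx.eq_or_lt with rfl | hx
    · simp [Real.zero_rpow hp]
    · rw [Real.rpow_sub_one hx.ne', div_mul_cancel₀ _ hx.ne']
  rw [mpow, mfun_eq_mul (Matrix.posSemidef_self_mul_conjTranspose M) hf, ← Matrix.mul_assoc,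
    mfun_intertwine (Matrix.isHermitian_mul_conjTranspose_self M)
      (Matrix.isHermitian_conjTranspose_mul_self M) M _ (Matrix.mul_assoc _ _ _)]
  rfl

lemma IsPureState.exists_eq_vecMulVec {ρ : Matrix n n ℂ} (hρ : IsPureState ρ) :
    ∃ ψ : n → ℂ, ρ = Matrix.vecMulVec ψ (star ψ) := by
  obtain ⟨⟨hpos, -⟩, hrank⟩ := hρ
  rw [hpos.1.rank_eq_card_non_zero_eigs, Fintype.card_eq_one_iff] at hrank
  obtain ⟨⟨k, _⟩, hk⟩ := hrank
  have hzero : ∀ i, i ≠ k → hpos.1.eigenvalues i = 0 := by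
    intro i hi
    by_contra h
    exact hi (congrArg Subtype.val (hk ⟨i, h⟩))
  refine ⟨fun i => (√(hpos.1.eigenvalues k) : ℂ) *
    (hpos.1.eigenvectorUnitary : Matrix n n ℂ) i k, ?_⟩
  have hsqrt : (√(hpos.1.eigenvalues k) : ℂ) * (√(hpos.1.eigenvalues k) : ℂ) =
      hpos.1.eigenvalues k := by
    exact_mod_cast Real.mul_self_sqrt (hpos.eigenvalues_nonneg k)
  ext i j
  conv_lhs => rw [isHermitian_eq_spectral hpos.1]
  rw [Matrix.mul_apply, Finset.sum_eq_single k]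
  · simp only [Matrix.mul_diagonal, Matrix.star_apply, Matrix.vecMulVec_apply, Pi.star_apply,
      star_mul', RCLike.star_def, Complex.conj_ofReal]
    rw [← hsqrt]
    ring
  · intro l _ hl
    simp [Matrix.mul_diagonal, hzero l hl]
  · simp

/-- The trace functional of the conditional Tsallis entropy of `M * Mᴴ`, where
`M` is the matrix of amplitudes `φ x y z` with row index `(x, y)` and column index `z`. -/
lemma trace_mpow_mul_mpow (φ : a → b → c → ℂ) {p q : ℝ} (hp : p ≠ 0)
    {ρ : Matrix (a × b) (a × b) ℂ} {σ : Matrix b b ℂ} {τ : Matrix c c ℂ}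
    (hρ : ∀ i j, ρ i j = ∑ z, φ i.1 i.2 z * star (φ j.1 j.2 z))
    (hσ : σ.IsHermitian)
    (hτ : ∀ i j, τ i j = ∑ x, ∑ y, φ x y i * star (φ x y j)) :
    Matrix.trace (mpow ρ p * mpow ((1 : Matrix a a ℂ) ⊗ₖ σ) q) =
      ∑ x, ∑ y, ∑ y', ∑ z, ∑ z', φ x y z * star (φ x y' z') *
        mpow τ (p - 1) z' z * mpow σ q y' y := by
  let M : Matrix (a × b) c ℂ := Matrix.of fun i z => φ i.1 i.2 z
  have hM : ρ = M * M.conjTranspose := by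
    ext i j
    simp [M, hρ, Matrix.mul_apply]
  have hM' : M.conjTranspose * M = τ.transpose := by
    ext i j
    simp [M, hτ, Matrix.mul_apply, Fintype.sum_prod_type, mul_comm]
  have hτH : τ.IsHermitian := by
    have := Matrix.isHermitian_conjTranspose_mul_self M
    rw [hM'] at this
    exact Matrix.isHermitian_transpose_iff.mp this
  rw [hM, mpow_mul_conjTranspose M hp, hM', mpow, mfun_transpose hτH, mpow, mfun_one_kronecker hσ]
  change ∑ i, _ = _
  simp only [Matrix.diag_apply, Matrix.mul_apply, Fintype.sum_prod_type, Matrix.kroneckerMap_apply,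
    Matrix.one_apply, Finset.sum_mul, Matrix.transpose_apply, M, Matrix.of_apply,
    Matrix.conjTranspose_apply, ite_mul, one_mul, zero_mul, mul_ite, mul_zero]
  refine Finset.sum_congr rfl fun x _ => Finset.sum_congr rfl fun y _ => ?_
  rw [Finset.sum_comm]
  simp only [Finset.sum_ite_eq', Finset.mem_univ, if_true]
  refine Finset.sum_congr rfl fun y' _ => ?_
  rw [Finset.sum_comm]
  refine Finset.sum_congr rfl fun z _ => Finset.sum_congr rfl fun z' _ => ?_
  simp only [mpow]
  ring

theorem condTsallisDown_duality {A B C : Type} [Fintype A] [DecidableEq A]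
    [Fintype B] [DecidableEq B] [Fintype C] [DecidableEq C]
    (α : ℝ) (hα : α ∈ Set.Ioo (0 : ℝ) 2)
    (ρ : Matrix (A × B × C) (A × B × C) ℂ) (hρ : IsPureState ρ) :
    condTsallisDown α (ptraceThird ρ) + condTsallisDown (2 - α) (ptraceMid ρ) = 0 := by
  obtain ⟨ψ, rfl⟩ := hρ.exists_eq_vecMulVec
  set ρ := Matrix.vecMulVec ψ (star ψ)
  by_cases h1 : α = 1
  · subst h1
    norm_num [condTsallisDown, tsallisRel]
  have hB : ∀ i j, ptraceA (ptraceThird ρ) i j =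
      ∑ x, ∑ z, ψ (x, i, z) * star (ψ (x, j, z)) := fun _ _ => rfl
  have hC : ∀ i j, ptraceA (ptraceMid ρ) i j =
      ∑ x, ∑ y, ψ (x, y, i) * star (ψ (x, y, j)) := fun _ _ => rfl
  have hBH : (ptraceA (ptraceThird ρ)).IsHermitian := by
    ext i j
    simp [hB, mul_comm]
  have hCH : (ptraceA (ptraceMid ρ)).IsHermitian := by
    ext i j
    simp [hC, mul_comm]
  have hAB := trace_mpow_mul_mpow (fun x y z => ψ (x, y, z)) (q := 1 - α) hα.1.ne'
    (ρ := ptraceThird ρ) (fun _ _ => rfl) hBH hC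
  have hAC := trace_mpow_mul_mpow (fun x z y => ψ (x, y, z)) (p := 2 - α) (q := 1 - (2 - α))
    (sub_pos.mpr hα.2).ne' (ρ := ptraceMid ρ) (fun _ _ => rfl) hCH hB
  have key : Matrix.trace (mpow (ptraceThird ρ) α *
        mpow ((1 : Matrix A A ℂ) ⊗ₖ ptraceA (ptraceThird ρ)) (1 - α)) =
      Matrix.trace (mpow (ptraceMid ρ) (2 - α) *
        mpow ((1 : Matrix A A ℂ) ⊗ₖ ptraceA (ptraceMid ρ)) (1 - (2 - α))) := by
    rw [hAB, hAC, show 2 - α - 1 = 1 - α by ring, show 1 - (2 - α) = α - 1 by ring]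
    refine Finset.sum_congr rfl fun x _ => ?_
    simp only [← Fintype.sum_prod_type']
    refine Fintype.sum_equiv
      ⟨fun t => (t.2.2.1, t.2.2.2, t.1, t.2.1), fun t => (t.2.2.1, t.2.2.2, t.1, t.2.1),
        fun _ => rfl, fun _ => rfl⟩ _ _ fun t => ?_
    simp only [Equiv.coe_fn_mk]
    ring
  simp only [condTsallisDown, tsallisRel, rtr, key]
  rw [show 2 - α - 1 = -(α - 1) by ring, inv_neg]
  ring

end QIT
end
end

section
/- Let α ∈ [1/2, 1). Let ρ_AB and σ_AB be bipartite states with the same marginal ρ_B = σ_B and trace distance (1/2)‖ρ − σ‖₁ = ε ∈ [0,1]. Then |T̃↓_α(A|B)_ρ − T̃↓_α(A|B)_σ| ≤ (1/(1−α))·((1 + ε^α)·(1+ε)^{1−α} − 1)·|A|^{1−α}. -/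
open scoped Kronecker ComplexOrder

noncomputable section

namespace QIT

variable {n : Type*} [Fintype n] [DecidableEq n]

variable {a b c r : Type*} [Fintype a] [DecidableEq a] [Fintype b] [DecidableEq b]
  [Fintype c] [DecidableEq c] [Fintype r] [DecidableEq r]

open Matrix Polynomial in
lemma rtr_mfun {A : Matrix n n ℂ} (hA : A.IsHermitian) (f : ℝ → ℝ) :
    rtr (mfun f A) = (A.charpoly.roots.map fun z => f z.re).sum := by
  rw [hA.roots_charpoly_eq_eigenvalues, rtr, mfun, dif_pos hA, trace_mul_comm, ← mul_assoc,
    Unitary.coe_star_mul_self, one_mul, trace_diagonal, Complex.re_sum]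
  simp

open Matrix in
lemma exists_unitary_diagonal {A : Matrix n n ℂ} (hA : A.IsHermitian) :
    ∃ (U : Matrix n n ℂ) (d : n → ℝ), Uᴴ * U = 1 ∧
      A = U * diagonal (fun i => (d i : ℂ)) * Uᴴ ∧ (A.PosSemidef → ∀ i, 0 ≤ d i) ∧
      ∀ f : ℝ → ℝ, mfun f A = U * diagonal (fun i => (f (d i) : ℂ)) * Uᴴ := by
  refine ⟨hA.eigenvectorUnitary, hA.eigenvalues, Unitary.coe_star_mul_self _, ?_,
    fun h => h.eigenvalues_nonneg, fun f => by rw [mfun, dif_pos hA]; rfl⟩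
  conv_lhs => rw [hA.spectral_theorem, Unitary.conjStarAlgAut_apply]
  rfl

open Matrix in
lemma isHermitian_conj_diagonal (V : Matrix n n ℂ) (d : n → ℝ) :
    (V * diagonal (fun i => (d i : ℂ)) * Vᴴ).IsHermitian := by
  refine isHermitian_mul_mul_conjTranspose V ?_
  simp [IsHermitian, diagonal_conjTranspose, Pi.star_def]

open Matrix in
lemma posSemidef_conj_diagonal (V : Matrix n n ℂ) {d : n → ℝ} (hd : ∀ i, 0 ≤ d i) :
    (V * diagonal (fun i => (d i : ℂ)) * Vᴴ).PosSemidef := by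
  refine PosSemidef.mul_mul_conjTranspose_same (posSemidef_diagonal_iff.2 fun i => ?_) V
  exact_mod_cast hd i

open Matrix in
lemma rtr_conj_diagonal {V : Matrix n n ℂ} (hV : Vᴴ * V = 1) (d : n → ℝ) :
    rtr (V * diagonal (fun i => (d i : ℂ)) * Vᴴ) = ∑ i, d i := by
  rw [rtr, trace_mul_comm, ← mul_assoc, hV, one_mul, trace_diagonal, Complex.re_sum]
  simp

open Matrix Polynomial in
lemma rtr_mfun_conj_diagonal {V : Matrix n n ℂ} (hV : Vᴴ * V = 1) (d : n → ℝ) (f : ℝ → ℝ) :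
    rtr (mfun f (V * diagonal (fun i => (d i : ℂ)) * Vᴴ)) = ∑ i, f (d i) := by
  rw [rtr_mfun (isHermitian_conj_diagonal V d), charpoly_mul_comm, ← mul_assoc, hV, one_mul,
    charpoly_diagonal, roots_prod _ _ (Finset.prod_ne_zero_iff.2 fun i _ => X_sub_C_ne_zero _)]
  simp

open Matrix Polynomial in
/-- The nonzero spectra of `M * Mᴴ` and `Mᴴ * M` agree. -/
lemma rtr_mfun_mul_conjTranspose_comm {m : Type*} [Fintype m] [DecidableEq m]
    (M : Matrix m n ℂ) {f : ℝ → ℝ} (hf : f 0 = 0) :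
    rtr (mfun f (M * Mᴴ)) = rtr (mfun f (Mᴴ * M)) := by
  rw [rtr_mfun (isHermitian_mul_conjTranspose_self M),
    rtr_mfun (isHermitian_conjTranspose_mul_self M)]
  have h := congrArg (fun p => (p.roots.map fun z => f z.re).sum) (charpoly_mul_comm' M Mᴴ)
  rw [roots_mul (mul_ne_zero (pow_ne_zero _ X_ne_zero) (charpoly_monic _).ne_zero),
    roots_mul (mul_ne_zero (pow_ne_zero _ X_ne_zero) (charpoly_monic _).ne_zero)] at h
  simpa [hf, Multiset.map_nsmul, Multiset.sum_nsmul] using h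

open Matrix in
lemma sum_normSq_row {W : Matrix n n ℂ} (hW : W * Wᴴ = 1) (j : n) :
    ∑ i, Complex.normSq (W j i) = 1 := by
  have h := congrFun (congrFun hW j) j
  simp only [mul_apply, conjTranspose_apply, Complex.star_def, Complex.mul_conj,
    one_apply_eq] at h
  exact_mod_cast h

open Matrix in
/-- Peierls' inequality for a concave function: diagonal entries in any orthonormal basis. -/
lemma rtr_mfun_le_sum_diag {f : ℝ → ℝ} (hf : ConcaveOn ℝ (Set.Ici 0) f) {A : Matrix n n ℂ}
    (hA : A.PosSemidef) {V : Matrix n n ℂ} (hV : Vᴴ * V = 1) :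
    rtr (mfun f A) ≤ ∑ j, f ((Vᴴ * A * V) j j).re := by
  obtain ⟨U, d, hU, hs, hd0, -⟩ := exists_unitary_diagonal hA.1
  specialize hd0 hA
  set W := Vᴴ * U with hWdef
  have hW : W * Wᴴ = 1 := by
    rw [hWdef, conjTranspose_mul, conjTranspose_conjTranspose, mul_assoc, ← mul_assoc U,
      mul_eq_one_comm.1 hU, one_mul, hV]
  have hW' : Wᴴ * Wᴴᴴ = 1 := by
    rw [conjTranspose_conjTranspose, mul_eq_one_comm.1 hW]
  have hdiag : ∀ j, ((Vᴴ * A * V) j j).re = ∑ i, Complex.normSq (W j i) * d i := by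
    intro j
    have : Vᴴ * A * V = W * diagonal (fun i => (d i : ℂ)) * Wᴴ := by
      rw [hs, hWdef, conjTranspose_mul, conjTranspose_conjTranspose]
      simp only [mul_assoc]
    rw [this, mul_apply, Complex.re_sum]
    refine Finset.sum_congr rfl fun i _ => ?_
    rw [mul_diagonal, conjTranspose_apply, mul_right_comm, Complex.star_def, Complex.mul_conj,
      ← Complex.ofReal_mul, Complex.ofReal_re]
  have hjensen : ∀ j, ∑ i, Complex.normSq (W j i) * f (d i) ≤ f ((Vᴴ * A * V) j j).re := by
    intro j
    rw [hdiag]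
    exact hf.le_map_sum (fun i _ => Complex.normSq_nonneg _) (sum_normSq_row hW j)
      fun i _ => hd0 i
  refine le_trans (le_of_eq ?_) (Finset.sum_le_sum fun j _ => hjensen j)
  rw [Finset.sum_comm, hs, rtr_mfun_conj_diagonal hU]
  refine Finset.sum_congr rfl fun i _ => ?_
  have h := sum_normSq_row hW' i
  simp only [conjTranspose_apply, Complex.star_def, Complex.normSq_conj] at h
  rw [← Finset.sum_mul, h, one_mul]

open Matrix in
lemma exists_rtr_mfun_eq_sum_diag {A : Matrix n n ℂ} (hA : A.IsHermitian) :
    ∃ U : Matrix n n ℂ, Uᴴ * U = 1 ∧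
      ∀ f : ℝ → ℝ, rtr (mfun f A) = ∑ j, f ((Uᴴ * A * U) j j).re := by
  obtain ⟨U, d, hU, hs, -⟩ := exists_unitary_diagonal hA
  refine ⟨U, hU, fun f => ?_⟩
  rw [hs, rtr_mfun_conj_diagonal hU]
  have : Uᴴ * (U * diagonal (fun i => (d i : ℂ)) * Uᴴ) * U = diagonal (fun i => (d i : ℂ)) := by
    rw [mul_assoc, mul_assoc, hU, mul_one, ← mul_assoc, hU, one_mul]
  simp [this]

open Matrix in
/-- Trace monotonicity for concave monotone functions. -/
lemma rtr_mfun_le_of_add {f : ℝ → ℝ} (hf : ConcaveOn ℝ (Set.Ici 0) f)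
    (hm : MonotoneOn f (Set.Ici 0)) {A B : Matrix n n ℂ} (hA : A.PosSemidef) (hB : B.PosSemidef) :
    rtr (mfun f A) ≤ rtr (mfun f (A + B)) := by
  obtain ⟨U, hU, hAB⟩ := exists_rtr_mfun_eq_sum_diag (hA.add hB).1
  rw [hAB f]
  refine (rtr_mfun_le_sum_diag hf hA hU).trans (Finset.sum_le_sum fun j _ => ?_)
  have h1 := (hA.conjTranspose_mul_mul_same U).diag_nonneg (i := j)
  have h2 := (hB.conjTranspose_mul_mul_same U).diag_nonneg (i := j)
  have h1' := (Complex.le_def.1 h1).1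
  have h2' := (Complex.le_def.1 h2).1
  rw [Complex.zero_re] at h1' h2'
  rw [mul_add, add_mul, Matrix.add_apply, Complex.add_re]
  exact hm h1' (add_nonneg h1' h2') (le_add_of_nonneg_right h2')

open Matrix in
lemma exists_eq_mul_conjTranspose {A : Matrix n n ℂ} (hA : A.PosSemidef) :
    ∃ M : Matrix n n ℂ, A = M * Mᴴ := by
  obtain ⟨U, d, -, hs, hd, -⟩ := exists_unitary_diagonal hA.1
  refine ⟨U * diagonal (fun i => ((√(d i) : ℝ) : ℂ)), ?_⟩
  have h : diagonal (fun i => ((√(d i) : ℝ) : ℂ)) *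
      (diagonal (fun i => ((√(d i) : ℝ) : ℂ)))ᴴ =
      diagonal (fun i => (d i : ℂ)) := by
    simp only [diagonal_conjTranspose, diagonal_mul_diagonal, Pi.star_apply, Complex.star_def,
      Complex.conj_ofReal, ← Complex.ofReal_mul, Real.mul_self_sqrt (hd hA _)]
  rw [conjTranspose_mul, mul_assoc, ← mul_assoc (diagonal _), h, ← mul_assoc, hs]

open Matrix in
/-- Rotfel'd's inequality: subadditivity of the trace of a concave function. -/
lemma rtr_mfun_add_le {f : ℝ → ℝ} (hf : ConcaveOn ℝ (Set.Ici 0) f) (h0 : f 0 = 0)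
    {A B : Matrix n n ℂ} (hA : A.PosSemidef) (hB : B.PosSemidef) :
    rtr (mfun f (A + B)) ≤ rtr (mfun f A) + rtr (mfun f B) := by
  obtain ⟨M, rfl⟩ := exists_eq_mul_conjTranspose hA
  obtain ⟨N, rfl⟩ := exists_eq_mul_conjTranspose hB
  have hG : M * Mᴴ + N * Nᴴ = fromCols M N * (fromCols M N)ᴴ := by
    rw [conjTranspose_fromCols_eq_fromRows_conjTranspose, fromCols_mul_fromRows]
  rw [hG, rtr_mfun_mul_conjTranspose_comm _ h0, rtr_mfun_mul_conjTranspose_comm M h0,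
    rtr_mfun_mul_conjTranspose_comm N h0]
  obtain ⟨U, hU, hM⟩ := exists_rtr_mfun_eq_sum_diag (isHermitian_conjTranspose_mul_self M)
  obtain ⟨V, hV, hN⟩ := exists_rtr_mfun_eq_sum_diag (isHermitian_conjTranspose_mul_self N)
  rw [hM f, hN f]
  have hW : (fromBlocks U 0 0 V)ᴴ * fromBlocks U 0 0 V = 1 := by
    simp [fromBlocks_conjTranspose, fromBlocks_multiply, hU, hV]
  refine (rtr_mfun_le_sum_diag hf (posSemidef_conjTranspose_mul_self _) hW).trans (le_of_eq ?_)
  rw [conjTranspose_fromCols_eq_fromRows_conjTranspose, fromRows_mul_fromCols,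
    fromBlocks_conjTranspose, fromBlocks_multiply, fromBlocks_multiply, Fintype.sum_sum_type]
  simp

open Matrix in
lemma mpow_isHermitian (T : Matrix n n ℂ) (s : ℝ) : (mpow T s).IsHermitian := by
  by_cases hT : T.IsHermitian
  · rw [mpow, mfun, dif_pos hT]
    exact isHermitian_conj_diagonal _ _
  · rw [mpow, mfun, dif_neg hT]
    exact isHermitian_zero

open Matrix in
lemma posSemidef_mpow_mul_mul_mpow {P : Matrix n n ℂ} (hP : P.PosSemidef) (T : Matrix n n ℂ)
    (s : ℝ) : (mpow T s * P * mpow T s).PosSemidef := by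
  have h := hP.mul_mul_conjTranspose_same (mpow T s)
  rwa [(mpow_isHermitian T s).eq] at h

open Matrix in
/-- Hölder's inequality for the sandwiched trace functional. -/
lemma sandTr_le {α : ℝ} (h0 : 0 < α) (h1 : α < 1) {P T : Matrix n n ℂ} (hP : P.PosSemidef)
    (hT : T.PosSemidef) : sandTr α P T ≤ rtr P ^ α * rtr T ^ (1 - α) := by
  set s := (1 - α) / (2 * α) with hsdef
  have hs0 : 0 < s := div_pos (by linarith) (by linarith)
  obtain ⟨U, t, hU, hTs, ht0, hTf⟩ := exists_unitary_diagonal hT.1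
  specialize ht0 hT
  have hm : mpow T s = U * diagonal (fun i => ((t i ^ s : ℝ) : ℂ)) * Uᴴ := hTf _
  have hpsd := posSemidef_mpow_mul_mul_mpow hP T s
  have key := rtr_mfun_le_sum_diag (Real.concaveOn_rpow h0.le h1.le) hpsd hU
  set R := Uᴴ * P * U with hR
  have hRpsd : R.PosSemidef := hP.conjTranspose_mul_mul_same U
  have hR0 : ∀ j, 0 ≤ (R j j).re := fun j => (Complex.le_def.1 (hRpsd.diag_nonneg (i := j))).1
  have hdiag : Uᴴ * (mpow T s * P * mpow T s) * U =
      diagonal (fun i => ((t i ^ s : ℝ) : ℂ)) * R * diagonal (fun i => ((t i ^ s : ℝ) : ℂ)) := by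
    rw [hm, hR]
    simp only [mul_assoc, hU, mul_one]
    rw [← mul_assoc Uᴴ U, hU, one_mul]
  have hterm : ∀ j, ((Uᴴ * (mpow T s * P * mpow T s) * U) j j).re ^ α =
      (R j j).re ^ α * t j ^ (1 - α) := by
    intro j
    rw [hdiag, mul_diagonal, diagonal_mul, mul_right_comm, ← Complex.ofReal_mul,
      Complex.re_ofReal_mul, ← Real.rpow_add' (ht0 j) (by positivity),
      Real.mul_rpow (Real.rpow_nonneg (ht0 j) _) (hR0 j), ← Real.rpow_mul (ht0 j), mul_comm]
    congr 2
    rw [hsdef]; field_simp; ring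
  have hRtr : ∑ j, (R j j).re = rtr P := by
    rw [← Complex.re_sum, rtr]
    congr 1
    change R.trace = _
    rw [hR, trace_mul_comm, ← mul_assoc, mul_eq_one_comm.1 hU, one_mul]
  have hTtr : ∑ j, t j = rtr T := by
    rw [hTs, rtr_conj_diagonal hU]
  calc sandTr α P T ≤ ∑ j, (R j j).re ^ α * t j ^ (1 - α) := by
        simp only [hterm] at key
        exact key
    _ ≤ (∑ j, ((R j j).re ^ α) ^ α⁻¹) ^ (1 / α⁻¹) *
        (∑ j, (t j ^ (1 - α)) ^ (1 - α)⁻¹) ^ (1 / (1 - α)⁻¹) :=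
      Real.inner_le_Lp_mul_Lq_of_nonneg _
        ((Real.holderConjugate_iff_eq_conjExponent (one_lt_inv₀ h0 |>.2 h1)).2 (by
          have : 1 - α ≠ 0 := by linarith
          field_simp))
        (fun j _ => Real.rpow_nonneg (hR0 j) _) (fun j _ => Real.rpow_nonneg (ht0 j) _)
    _ = rtr P ^ α * rtr T ^ (1 - α) := by
      have h1' : 1 - α ≠ 0 := by linarith
      simp only [Real.rpow_rpow_inv (hR0 _) h0.ne', Real.rpow_rpow_inv (ht0 _) h1', one_div,
        inv_inv, hRtr, hTtr]

lemma sandTr_le_sandTr_add {α : ℝ} (h0 : 0 ≤ α) (h1 : α ≤ 1) {P Q : Matrix n n ℂ}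
    (hP : P.PosSemidef) (hQ : Q.PosSemidef) (T : Matrix n n ℂ) :
    sandTr α P T ≤ sandTr α (P + Q) T := by
  rw [sandTr, sandTr, mul_add, add_mul]
  exact rtr_mfun_le_of_add (Real.concaveOn_rpow h0 h1)
    (fun x hx y _ hxy => Real.rpow_le_rpow hx hxy h0)
    (posSemidef_mpow_mul_mul_mpow hP T _) (posSemidef_mpow_mul_mul_mpow hQ T _)

lemma sandTr_add_le {α : ℝ} (h0 : 0 < α) (h1 : α ≤ 1) {P Q : Matrix n n ℂ}
    (hP : P.PosSemidef) (hQ : Q.PosSemidef) (T : Matrix n n ℂ) :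
    sandTr α (P + Q) T ≤ sandTr α P T + sandTr α Q T := by
  rw [sandTr, mul_add, add_mul]
  exact rtr_mfun_add_le (Real.concaveOn_rpow h0.le h1) (Real.zero_rpow h0.ne')
    (posSemidef_mpow_mul_mul_mpow hP T _) (posSemidef_mpow_mul_mul_mpow hQ T _)

open Matrix in
/-- Jordan decomposition of a traceless hermitian matrix. -/
lemma exists_posSemidef_sub_eq {D : Matrix n n ℂ} (hD : D.IsHermitian) (htr : rtr D = 0) :
    ∃ P Q : Matrix n n ℂ, P.PosSemidef ∧ Q.PosSemidef ∧ D = P - Q ∧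
      rtr Q = 2⁻¹ * traceNorm D := by
  obtain ⟨U, d, hU, hs, -⟩ := exists_unitary_diagonal hD
  refine ⟨U * diagonal (fun i => ((max (d i) 0 : ℝ) : ℂ)) * Uᴴ,
    U * diagonal (fun i => ((max (-d i) 0 : ℝ) : ℂ)) * Uᴴ,
    posSemidef_conj_diagonal U fun i => le_max_right _ _,
    posSemidef_conj_diagonal U fun i => le_max_right _ _, ?_, ?_⟩
  · rw [← sub_mul, ← mul_sub, diagonal_sub, hs]
    simp only [← Complex.ofReal_sub, max_zero_sub_eq_self]
  · have hsq : Dᴴ * D = U * diagonal (fun i => ((d i ^ 2 : ℝ) : ℂ)) * Uᴴ := by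
      rw [hD.eq, hs]
      simp only [mul_assoc]
      rw [← mul_assoc Uᴴ U, hU, one_mul, ← mul_assoc (diagonal _) (diagonal _),
        diagonal_mul_diagonal]
      simp [pow_two]
    have hn : traceNorm D = ∑ i, |d i| := by
      rw [traceNorm, mpow, hsq, rtr_mfun_conj_diagonal hU]
      refine Finset.sum_congr rfl fun i _ => ?_
      rw [← one_div, ← Real.sqrt_eq_rpow, Real.sqrt_sq_eq_abs]
    rw [hs, rtr_conj_diagonal hU] at htr
    rw [rtr_conj_diagonal hU, hn, Finset.mul_sum]
    have : ∀ i, max (-d i) 0 = 2⁻¹ * |d i| - 2⁻¹ * d i := fun i => by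
      rcases le_total 0 (d i) with h | h
      · rw [max_eq_right (by linarith), abs_of_nonneg h]; ring
      · rw [max_eq_left (by linarith), abs_of_nonpos h]; ring
    simp only [this, Finset.sum_sub_distrib]
    rw [← Finset.mul_sum _ d, htr, mul_zero, sub_zero]

open Matrix in
lemma traceNorm_sub_comm (P Q : Matrix n n ℂ) : traceNorm (P - Q) = traceNorm (Q - P) := by
  rw [traceNorm, ← neg_sub Q P, conjTranspose_neg, neg_mul_neg, traceNorm]

lemma sandTr_le_sandTr_add_traceNorm {α : ℝ} (h0 : 0 < α) (h1 : α < 1) {ρ σ T : Matrix n n ℂ}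
    (hρ : ρ.PosSemidef) (hσ : σ.PosSemidef) (htr : rtr ρ = rtr σ) (hT : T.PosSemidef) :
    sandTr α σ T ≤
      sandTr α ρ T + (2⁻¹ * traceNorm (ρ - σ)) ^ α * rtr T ^ (1 - α) := by
  have hD : rtr (ρ - σ) = 0 := by
    rw [rtr, Matrix.trace_sub, Complex.sub_re, sub_eq_zero]
    exact htr
  obtain ⟨P, Q, hP, hQ, hPQ, hQtr⟩ := exists_posSemidef_sub_eq (hρ.1.sub hσ.1) hD
  have hsum : σ + P = ρ + Q := by rw [sub_eq_sub_iff_add_eq_add] at hPQ; rw [hPQ, add_comm]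
  rw [← hQtr]
  calc sandTr α σ T ≤ sandTr α (ρ + Q) T :=
        hsum ▸ sandTr_le_sandTr_add h0.le h1.le hσ hP T
    _ ≤ sandTr α ρ T + sandTr α Q T := sandTr_add_le h0 h1.le hρ hQ T
    _ ≤ _ := by gcongr; exact sandTr_le h0 h1 hQ hT

lemma posSemidef_ptraceA {l m : Type*} [Fintype l] {ρ : Matrix (l × m) (l × m) ℂ}
    (hρ : ρ.PosSemidef) :
    (ptraceA ρ).PosSemidef := by
  have h : ptraceA ρ = ∑ k : l, ρ.submatrix (fun i => (k, i)) (fun i => (k, i)) := by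
    ext i j
    simp [ptraceA, Matrix.sum_apply]
  rw [h]
  exact Matrix.posSemidef_sum _ fun k _ => hρ.submatrix _

lemma trace_ptraceA {l m : Type*} [Fintype l] [Fintype m] (ρ : Matrix (l × m) (l × m) ℂ) :
    (ptraceA ρ).trace = ρ.trace := by
  simp only [Matrix.trace, Matrix.diag, ptraceA, Matrix.of_apply, Fintype.sum_prod_type]
  exact Finset.sum_comm

theorem condTsallisSandDown_continuity {A B : Type} [Fintype A] [DecidableEq A] [Fintype B] [DecidableEq B]
    (α : ℝ) (hα : α ∈ Set.Ico (2⁻¹ : ℝ) 1)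
    (ρ σ : Matrix (A × B) (A × B) ℂ) (hρ : IsState ρ) (hσ : IsState σ)
    (hmarg : ptraceA ρ = ptraceA σ)
    (ε : ℝ) (hε : ε ∈ Set.Icc (0 : ℝ) 1) (hdist : 2⁻¹ * traceNorm (ρ - σ) = ε) :
    |condTsallisSandDown α ρ - condTsallisSandDown α σ|
      ≤ (1 - α)⁻¹ * ((1 + ε ^ α) * (1 + ε) ^ (1 - α) - 1) * (Fintype.card A : ℝ) ^ (1 - α) := by
  obtain ⟨hα0, hα1⟩ := hα
  have h0 : 0 < α := lt_of_lt_of_le (by norm_num) hα0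
  have hT : ((1 : Matrix A A ℂ) ⊗ₖ ptraceA σ).PosSemidef :=
    Matrix.PosSemidef.one.kronecker (posSemidef_ptraceA hσ.1)
  have hTtr : rtr ((1 : Matrix A A ℂ) ⊗ₖ ptraceA σ) = Fintype.card A := by
    rw [rtr, Matrix.trace_kronecker, trace_ptraceA, hσ.2, Matrix.trace_one, mul_one,
      Complex.natCast_re]
  have htr : rtr ρ = rtr σ := by rw [rtr, rtr, hρ.2, hσ.2]
  have h1 := sandTr_le_sandTr_add_traceNorm h0 hα1 hρ.1 hσ.1 htr hT
  have h2 := sandTr_le_sandTr_add_traceNorm h0 hα1 hσ.1 hρ.1 htr.symm hT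
  rw [traceNorm_sub_comm] at h2
  rw [hdist, hTtr] at h1 h2
  have hcoef : ε ^ α ≤ (1 + ε ^ α) * (1 + ε) ^ (1 - α) - 1 := by
    have h3 : 1 ≤ (1 + ε) ^ (1 - α) :=
      Real.one_le_rpow (by linarith [hε.1]) (by linarith)
    nlinarith [Real.rpow_nonneg hε.1 α]
  have hinv : 0 ≤ (1 - α)⁻¹ := inv_nonneg.2 (by linarith)
  have hdiff : condTsallisSandDown α ρ - condTsallisSandDown α σ = (1 - α)⁻¹ *
      (sandTr α ρ ((1 : Matrix A A ℂ) ⊗ₖ ptraceA σ) -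
        sandTr α σ ((1 : Matrix A A ℂ) ⊗ₖ ptraceA σ)) := by
    rw [condTsallisSandDown, condTsallisSandDown, sandTsallis, sandTsallis, hmarg,
      ← neg_sub 1 α, inv_neg]
    ring
  rw [hdiff, abs_mul, abs_of_nonneg hinv, mul_assoc]
  gcongr
  calc _ ≤ ε ^ α * (Fintype.card A : ℝ) ^ (1 - α) := abs_le.2 ⟨by linarith, by linarith⟩
    _ ≤ _ := by gcongr

end QIT
end
end

section
/- Let Φ_σ: A→B be the replacer channel Φ_σ(ρ) = Tr(ρ)·σ for a fixed state σ on H_B. Then the channel relative entropy to the completely randomizing channel satisfies D(Φ_σ ‖ R_{A→B}) = D(σ‖π_B), and consequently the channel entropy satisfies S(Φ_σ) = S(σ); in particular, if σ is a pure state then S(Φ_σ) = 0. -/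
open scoped Kronecker ComplexOrder

noncomputable section

namespace QIT

variable {n : Type*} [Fintype n] [DecidableEq n]

variable {a b c r : Type*} [Fintype a] [DecidableEq a] [Fintype b] [DecidableEq b]
  [Fintype c] [DecidableEq c] [Fintype r] [DecidableEq r]

/-- The functional calculus may be computed in any unitary diagonalization. -/
lemma mfun_of_diagonalization (f : ℝ → ℝ) {A U : Matrix n n ℂ} {d : n → ℝ}
    (hU : U ∈ Matrix.unitaryGroup n ℂ)
    (hA : A = U * Matrix.diagonal (fun i => (d i : ℂ)) * star U) :
    mfun f A = U * Matrix.diagonal (fun i => ((f (d i) : ℝ) : ℂ)) * star U := by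
  have hherm : A.IsHermitian := by
    rw [hA, Matrix.star_eq_conjTranspose]
    apply Matrix.isHermitian_mul_mul_conjTranspose
    rw [Matrix.isHermitian_diagonal_iff]
    intro i
    simp [IsSelfAdjoint]
  rw [mfun, dif_pos hherm]
  have hspec : A = (hherm.eigenvectorUnitary : Matrix n n ℂ) *
      Matrix.diagonal (fun i => (hherm.eigenvalues i : ℂ)) *
      star (hherm.eigenvectorUnitary : Matrix n n ℂ) := by
    conv_lhs => rw [hherm.spectral_theorem, Unitary.conjStarAlgAut_apply]
    rfl
  generalize hherm.eigenvalues = e at hspec ⊢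
  have hV := hherm.eigenvectorUnitary.2
  generalize (hherm.eigenvectorUnitary : Matrix n n ℂ) = V at hV hspec ⊢
  have hVV : star V * V = 1 := Matrix.mem_unitaryGroup_iff'.mp hV
  have hVV' : V * star V = 1 := Matrix.mem_unitaryGroup_iff.mp hV
  have hUU : star U * U = 1 := Matrix.mem_unitaryGroup_iff'.mp hU
  have hUU' : U * star U = 1 := Matrix.mem_unitaryGroup_iff.mp hU
  have hcomm : Matrix.diagonal (fun i => (e i : ℂ)) * (star V * U)
      = (star V * U) * Matrix.diagonal (fun i => (d i : ℂ)) := by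
    have h := congrArg (fun M => star V * M * U) (hspec.symm.trans hA)
    simp only [Matrix.mul_assoc, hUU, Matrix.mul_one] at h
    rwa [← Matrix.mul_assoc (star V) V, hVV, Matrix.one_mul, ← Matrix.mul_assoc (star V) U] at h
  have hcommf : Matrix.diagonal (fun i => ((f (e i) : ℝ) : ℂ)) * (star V * U)
      = (star V * U) * Matrix.diagonal (fun i => ((f (d i) : ℝ) : ℂ)) := by
    ext i j
    have h := congrFun (congrFun hcomm i) j
    rw [Matrix.diagonal_mul, Matrix.mul_diagonal] at h ⊢
    by_cases h0 : (star V * U) i j = 0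
    · simp [h0]
    · rw [mul_comm] at h
      have hed : e i = d j := by exact_mod_cast mul_left_cancel₀ h0 h
      rw [hed, mul_comm]
  calc V * Matrix.diagonal (fun i => ((f (e i) : ℝ) : ℂ)) * star V
      = V * (Matrix.diagonal (fun i => ((f (e i) : ℝ) : ℂ)) * (star V * U)) * star U := by
        simp only [Matrix.mul_assoc, hUU', Matrix.mul_one]
    _ = (V * star V) * U * Matrix.diagonal (fun i => ((f (d i) : ℝ) : ℂ)) * star U := by
        rw [hcommf]; simp only [Matrix.mul_assoc]
    _ = _ := by rw [hVV', Matrix.one_mul]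

lemma rtr_mul_mlog_of_diagonalization {A B U : Matrix n n ℂ} {d e : n → ℝ}
    (hU : U ∈ Matrix.unitaryGroup n ℂ)
    (hA : A = U * Matrix.diagonal (fun i => (d i : ℂ)) * star U)
    (hB : B = U * Matrix.diagonal (fun i => (e i : ℂ)) * star U) :
    rtr (A * mlog B) = ∑ i, d i * Real.logb 2 (e i) := by
  have hUU : star U * U = 1 := Matrix.mem_unitaryGroup_iff'.mp hU
  rw [mlog, mfun_of_diagonalization _ hU hB, hA, rtr]
  have h : U * Matrix.diagonal (fun i => (d i : ℂ)) * star U *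
      (U * Matrix.diagonal (fun i => ((Real.logb 2 (e i) : ℝ) : ℂ)) * star U)
      = U * (Matrix.diagonal (fun i => (d i : ℂ)) *
        Matrix.diagonal (fun i => ((Real.logb 2 (e i) : ℝ) : ℂ))) * star U := by
    calc _ = U * Matrix.diagonal (fun i => (d i : ℂ)) * (star U * U) *
          Matrix.diagonal (fun i => ((Real.logb 2 (e i) : ℝ) : ℂ)) * star U := by
          simp only [Matrix.mul_assoc]
      _ = _ := by rw [hUU, Matrix.mul_one]; simp only [Matrix.mul_assoc]
  rw [h, Matrix.trace_mul_cycle, hUU, Matrix.one_mul, Matrix.diagonal_mul_diagonal,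
    Matrix.trace_diagonal, Complex.re_sum]
  refine Finset.sum_congr rfl fun i _ => ?_
  rw [← Complex.ofReal_mul, Complex.ofReal_re]

lemma IsState.exists_diagonalization {σ : Matrix n n ℂ} (hσ : IsState σ) :
    ∃ U ∈ Matrix.unitaryGroup n ℂ, ∃ d : n → ℝ,
      σ = U * Matrix.diagonal (fun i => (d i : ℂ)) * star U ∧ (∀ i, 0 ≤ d i) ∧ ∑ i, d i = 1 ∧
        σ.rank = Fintype.card {i // d i ≠ 0} := by
  have hH := hσ.1.isHermitian
  refine ⟨hH.eigenvectorUnitary, hH.eigenvectorUnitary.2, hH.eigenvalues, ?_,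
    hσ.1.eigenvalues_nonneg, ?_, hH.rank_eq_card_non_zero_eigs⟩
  · conv_lhs => rw [hH.spectral_theorem, Unitary.conjStarAlgAut_apply]
    rfl
  · have h := hH.trace_eq_sum_eigenvalues
    rw [hσ.2] at h
    have h' : ((∑ i, hH.eigenvalues i : ℝ) : ℂ) = 1 := by
      rw [h]; push_cast; rfl
    exact_mod_cast h'

lemma maxMixed_diagonalization {U : Matrix n n ℂ} (hU : U ∈ Matrix.unitaryGroup n ℂ) :
    maxMixed n = U * Matrix.diagonal (fun _ => (((Fintype.card n : ℝ)⁻¹ : ℝ) : ℂ)) * star U := by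
  have hUU' : U * star U = 1 := Matrix.mem_unitaryGroup_iff.mp hU
  rw [show Matrix.diagonal (fun _ : n => (((Fintype.card n : ℝ)⁻¹ : ℝ) : ℂ))
      = ((Fintype.card n : ℂ))⁻¹ • (1 : Matrix n n ℂ) by
    rw [Matrix.smul_one_eq_diagonal]; simp]
  rw [Matrix.mul_smul, Matrix.mul_one, Matrix.smul_mul, hUU', maxMixed]

lemma relEnt_maxMixed [Nonempty n] {σ : Matrix n n ℂ} (hσ : IsState σ) :
    relEnt σ (maxMixed n) = Real.logb 2 (Fintype.card n) - vnEnt σ := by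
  obtain ⟨U, hU, d, hσd, -, hsum, -⟩ := hσ.exists_diagonalization
  rw [relEnt, vnEnt, rtr_mul_mlog_of_diagonalization hU hσd (maxMixed_diagonalization hU),
    ← Finset.sum_mul, hsum, Real.logb_inv]
  ring

lemma vnEnt_eq_zero_of_rank_eq_one {σ : Matrix n n ℂ} (hσ : IsState σ) (hrank : σ.rank = 1) :
    vnEnt σ = 0 := by
  obtain ⟨U, hU, d, hσd, -, hsum, hcard⟩ := hσ.exists_diagonalization
  rw [hrank] at hcard
  obtain ⟨⟨i₀, _⟩, huniq⟩ := Fintype.card_eq_one_iff.mp hcard.symm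
  have hzero : ∀ i, i ≠ i₀ → d i = 0 := by
    intro i hi
    by_contra h
    exact hi (congrArg Subtype.val (huniq ⟨i, h⟩))
  have hone : d i₀ = 1 := by
    rwa [Finset.sum_eq_single i₀ (fun i _ hi => hzero i hi) (by simp)] at hsum
  rw [vnEnt, rtr_mul_mlog_of_diagonalization hU hσd hσd,
    Finset.sum_eq_single i₀ (fun i _ hi => by simp [hzero i hi]) (by simp), hone]
  simp

/-- Tensoring both arguments with a common state leaves the relative entropy to the maximally
mixed state unchanged. -/
lemma relEnt_kronecker_maxMixed [Nonempty b] {σ : Matrix b b ℂ} {ω : Matrix r r ℂ}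
    (hσ : IsState σ) (hω : IsState ω) :
    relEnt (σ ⊗ₖ ω) (maxMixed b ⊗ₖ ω) = relEnt σ (maxMixed b) := by
  obtain ⟨U, hU, d, hσd, -, hdsum, -⟩ := hσ.exists_diagonalization
  obtain ⟨V, hV, e, hωe, -, hesum, -⟩ := hω.exists_diagonalization
  have hπ := maxMixed_diagonalization hU
  have hUV : U ⊗ₖ V ∈ Matrix.unitaryGroup (b × r) ℂ := Matrix.kronecker_mem_unitary hU hV
  have hkron : ∀ (A : Matrix b b ℂ) (x : b → ℝ),
      A = U * Matrix.diagonal (fun i => (x i : ℂ)) * star U →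
      A ⊗ₖ ω = (U ⊗ₖ V) * Matrix.diagonal (fun p : b × r => ((x p.1 * e p.2 : ℝ) : ℂ))
        * star (U ⊗ₖ V) := by
    intro A x hA
    rw [hA, hωe, Matrix.star_eq_conjTranspose, Matrix.star_eq_conjTranspose,
      Matrix.star_eq_conjTranspose, Matrix.conjTranspose_kronecker, Matrix.mul_kronecker_mul,
      Matrix.mul_kronecker_mul, Matrix.diagonal_kronecker_diagonal]
    simp
  rw [relEnt, relEnt, rtr_mul_mlog_of_diagonalization hUV (hkron _ _ hσd) (hkron _ _ hσd),
    rtr_mul_mlog_of_diagonalization hUV (hkron _ _ hσd) (hkron _ (fun _ => _) hπ),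
    rtr_mul_mlog_of_diagonalization hU hσd hσd, rtr_mul_mlog_of_diagonalization hU hσd hπ,
    ← Finset.sum_sub_distrib, ← Finset.sum_sub_distrib, Fintype.sum_prod_type]
  refine Finset.sum_congr rfl fun i _ => ?_
  have hc : ((Fintype.card b : ℝ)⁻¹) ≠ 0 := by simp
  have hterm : ∀ j, d i * e j * Real.logb 2 (d i * e j)
      - d i * e j * Real.logb 2 ((Fintype.card b : ℝ)⁻¹ * e j)
      = e j * (d i * Real.logb 2 (d i) - d i * Real.logb 2 ((Fintype.card b : ℝ)⁻¹)) := by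
    intro j
    by_cases hd : d i = 0
    · simp [hd]
    by_cases he : e j = 0
    · simp [he]
    rw [Real.logb_mul hd he, Real.logb_mul hc he]
    ring
  simp only [hterm]
  rw [← Finset.sum_mul, hesum, one_mul]

set_option linter.unusedSectionVars false in
lemma IsState.ptraceA {ρ : Matrix (a × b) (a × b) ℂ} (hρ : IsState ρ) : IsState (ptraceA ρ) := by
  constructor
  · have h : QIT.ptraceA ρ
        = ∑ k : a, ρ.submatrix (fun i : b => (k, i)) (fun i : b => (k, i)) := by
      ext i j
      simp [QIT.ptraceA, Matrix.sum_apply]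
    rw [h]
    exact Matrix.posSemidef_sum _ fun k _ => hρ.1.submatrix _
  · rw [← hρ.2]
    simp only [Matrix.trace, QIT.ptraceA, Matrix.diag_apply, Matrix.of_apply,
      Fintype.sum_prod_type]
    exact Finset.sum_comm

lemma isState_maxMixed [Nonempty n] : IsState (maxMixed n) := by
  constructor
  · apply Matrix.PosSemidef.one.smul
    positivity
  · simp [maxMixed, Matrix.trace_smul]

set_option linter.unusedSectionVars false in
lemma tensorId_replacer (σ : Matrix b b ℂ) (ρ : Matrix (a × r) (a × r) ℂ) :
    tensorId (replacer a σ) r ρ = σ ⊗ₖ ptraceA ρ := by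
  ext p q
  simp [tensorId, replacer, ptraceA, Matrix.trace, mul_comm]

lemma chRelEnt_replacer_randomizing [Nonempty a] [Nonempty b] {σ : Matrix b b ℂ}
    (hσ : IsState σ) :
    chRelEnt (replacer a σ) (randomizing a b) = relEnt σ (maxMixed b) := by
  have : Nonempty (Σ k : ℕ, {ρ : Matrix (a × Fin k) (a × Fin k) ℂ // IsState ρ}) :=
    ⟨⟨1, maxMixed _, isState_maxMixed⟩⟩
  have hconst : ∀ p : Σ k : ℕ, {ρ : Matrix (a × Fin k) (a × Fin k) ℂ // IsState ρ},
      relEnt (tensorId (replacer a σ) (Fin p.1) p.2.1)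
        (tensorId (randomizing a b) (Fin p.1) p.2.1) = relEnt σ (maxMixed b) := by
    intro p
    rw [show randomizing a b = replacer a (maxMixed b) from rfl, tensorId_replacer,
      tensorId_replacer, relEnt_kronecker_maxMixed hσ p.2.2.ptraceA]
  rw [chRelEnt, iSup_congr hconst, ciSup_const]

theorem replacer_channel_entropy {A B : Type} [Fintype A] [DecidableEq A] [Nonempty A]
    [Fintype B] [DecidableEq B] [Nonempty B]
    (σ : Matrix B B ℂ) (hσ : IsState σ) :
    chRelEnt (replacer A σ) (randomizing A B) = relEnt σ (maxMixed B)
      ∧ chEnt (replacer A σ) = vnEnt σ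
      ∧ (σ.rank = 1 → chEnt (replacer A σ) = 0) := by
  have hrel := chRelEnt_replacer_randomizing (a := A) hσ
  have hent : chEnt (replacer A σ) = vnEnt σ := by
    rw [chEnt, hrel, relEnt_maxMixed hσ]
    ring
  exact ⟨hrel, hent, fun hrank => hent.trans (vnEnt_eq_zero_of_rank_eq_one hσ hrank)⟩

end QIT
end
end
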